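/- Let Q be a union of conjunctive queries with negation and inequalities (UCQ¬,≠) and ρ a distribution policy. If Q is not parallel-complete under ρ, then there is an instance J of facts over the universe of ρ with |adom(J)| ≤ varmax(Q) such that Q is not parallel-complete on J under ρ. -/

import Mathlib

/-- An atom `R(x₁,…,x_k)`: a relation name together with a tuple of variables. -/
structure Atom (R V : Type) where
  rel : R
  args : List V
deriving DecidableEq

/-- A fact `R(t)`: a relation name together with a tuple of data values. -/
structure DBFact (R D : Type) where
  rel : R
  args : List D
deriving DecidableEq

/-- Applying a valuation to an atom yields a fact. -/
def Atom.app {R V D : Type} (f : V → D) (a : Atom R V) : DBFact R D :=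
  ⟨a.rel, a.args.map f⟩

/-- The variables occurring in an atom. -/
def Atom.vars {R V : Type} (a : Atom R V) : Set V := {v | v ∈ a.args}

/-- A conjunctive query with negation and inequalities (CQ¬,≠): a head atom,
finite sets of positive and negated body atoms, and a finite set of
inequalities between variables. -/
structure CQ (R V : Type) where
  head : Atom R V
  pos : Finset (Atom R V)
  neg : Finset (Atom R V)
  ineq : Finset (V × V)

namespace CQ

variable {R V D : Type}

/-- The variables occurring in a query. -/
def vars (Q : CQ R V) : Set V :=
  Q.head.vars ∪ (⋃ a ∈ (↑Q.pos : Set (Atom R V)), a.vars) ∪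
    (⋃ a ∈ (↑Q.neg : Set (Atom R V)), a.vars) ∪
    (⋃ p ∈ (↑Q.ineq : Set (V × V)), {p.1, p.2})

/-- Safety: every head variable and every variable of a negated atom occurs in
some positive atom. -/
def safe (Q : CQ R V) : Prop :=
  (∀ v ∈ Q.head.vars, ∃ a ∈ Q.pos, v ∈ a.args) ∧
  (∀ a ∈ Q.neg, ∀ v ∈ a.args, ∃ b ∈ Q.pos, v ∈ b.args)

/-- A query is full if every one of its variables occurs in its head atom. -/
def isFull (Q : CQ R V) : Prop := ∀ v ∈ Q.vars, v ∈ Q.head.args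

/-- The facts required by a valuation `f`: `f(pos(Q))`. -/
def posFacts (Q : CQ R V) (f : V → D) : Set (DBFact R D) :=
  Atom.app f '' (↑Q.pos : Set (Atom R V))

/-- The facts prohibited by a valuation `f`: `f(neg(Q))`. -/
def negFacts (Q : CQ R V) (f : V → D) : Set (DBFact R D) :=
  Atom.app f '' (↑Q.neg : Set (Atom R V))

/-- `f` is a valuation for `Q`: required and prohibited facts are disjoint and
all inequalities are respected. -/
def isVal (Q : CQ R V) (f : V → D) : Prop :=
  Q.posFacts f ∩ Q.negFacts f = ∅ ∧
  ∀ p ∈ Q.ineq, f p.1 ≠ f p.2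

/-- `f` satisfies `Q` on `I`: all required facts are in `I` and no prohibited
fact is in `I`. -/
def sat (Q : CQ R V) (f : V → D) (I : Set (DBFact R D)) : Prop :=
  Q.posFacts f ⊆ I ∧ Q.negFacts f ∩ I = ∅

/-- `Q(I)`: the set of facts derived on `I` by valuations satisfying `Q`. -/
def eval (Q : CQ R V) (I : Set (DBFact R D)) : Set (DBFact R D) :=
  {fc | ∃ f : V → D, Q.isVal f ∧ Q.sat f I ∧ Atom.app f Q.head = fc}

end CQ

/-- A union of conjunctive queries (with negation and inequalities): a finite,
nonempty family of CQ¬,≠s. -/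
structure UCQ (R V : Type) where
  n : ℕ
  npos : 0 < n
  disj : Fin n → CQ R V

namespace UCQ

variable {R V D : Type}

/-- Well-formedness of a UCQ: every disjunct is safe, all disjuncts have the
same head relation, and distinct disjuncts have disjoint variable sets. -/
def wf (Q : UCQ R V) : Prop :=
  (∀ i, (Q.disj i).safe) ∧
  (∀ i j, (Q.disj i).head.rel = (Q.disj j).head.rel) ∧
  (∀ i j, i ≠ j → Disjoint (Q.disj i).vars (Q.disj j).vars)

/-- `Q(I) = ⋃ᵢ Qᵢ(I)`. -/
def eval (Q : UCQ R V) (I : Set (DBFact R D)) : Set (DBFact R D) :=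
  ⋃ i, (Q.disj i).eval I

/-- The maximum number of variables of any disjunct. -/
noncomputable def varmax (Q : UCQ R V) : ℕ :=
  Finset.univ.sup fun i => ((Q.disj i).vars).ncard

end UCQ

/-- The values of the fact all belong to `U`. -/
def DBFact.valsIn {R D : Type} (fc : DBFact R D) (U : Set D) : Prop :=
  ∀ d ∈ fc.args, d ∈ U

/-- The active domain of an instance: all data values occurring in it. -/
def adom {R D : Type} (I : Set (DBFact R D)) : Set D :=
  {d | ∃ fc ∈ I, d ∈ fc.args}

/-- A distribution policy over network (node type) `K`: a universe `U` of data
values and, for each node, the set of facts (with values from `U`) it is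
responsible for. -/
structure Policy (R D K : Type) where
  U : Set D
  rfacts : K → Set (DBFact R D)
  rfacts_vals : ∀ κ, ∀ fc ∈ rfacts κ, fc.valsIn U

namespace Policy
variable {R D K : Type}
/-- The local instance at node `κ`. -/
def dist (ρ : Policy R D K) (I : Set (DBFact R D)) (κ : K) : Set (DBFact R D) :=
  I ∩ ρ.rfacts κ
end Policy

/-- `I` is an instance (finite set of facts) with values from `U`. -/
def instOver {R D : Type} (I : Set (DBFact R D)) (U : Set D) : Prop :=
  I.Finite ∧ ∀ fc ∈ I, fc.valsIn U

section Parallel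
variable {R D K : Type}

/-- `q` is parallel-sound on `I` under `ρ`. -/
def parSoundOn (q : Set (DBFact R D) → Set (DBFact R D)) (ρ : Policy R D K)
    (I : Set (DBFact R D)) : Prop :=
  (⋃ κ : K, q (ρ.dist I κ)) ⊆ q I

/-- `q` is parallel-complete on `I` under `ρ`. -/
def parCompleteOn (q : Set (DBFact R D) → Set (DBFact R D)) (ρ : Policy R D K)
    (I : Set (DBFact R D)) : Prop :=
  q I ⊆ ⋃ κ : K, q (ρ.dist I κ)

/-- `q` is parallel-correct on `I` under `ρ`. -/
def parCorrectOn (q : Set (DBFact R D) → Set (DBFact R D)) (ρ : Policy R D K)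
    (I : Set (DBFact R D)) : Prop :=
  q I = ⋃ κ : K, q (ρ.dist I κ)

/-- `q` is parallel-sound under `ρ`: sound on every instance with values from
the universe of `ρ`. -/
def parSound (q : Set (DBFact R D) → Set (DBFact R D)) (ρ : Policy R D K) : Prop :=
  ∀ I : Set (DBFact R D), instOver I ρ.U → parSoundOn q ρ I

/-- `q` is parallel-complete under `ρ`. -/
def parComplete (q : Set (DBFact R D) → Set (DBFact R D)) (ρ : Policy R D K) : Prop :=
  ∀ I : Set (DBFact R D), instOver I ρ.U → parCompleteOn q ρ I

/-- `q` is parallel-correct under `ρ`. -/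
def parCorrect (q : Set (DBFact R D) → Set (DBFact R D)) (ρ : Policy R D K) : Prop :=
  ∀ I : Set (DBFact R D), instOver I ρ.U → parCorrectOn q ρ I

end Parallel

/-- The facts of `I` all of whose values belong to `S`. -/
def restrictTo {R D : Type} (I : Set (DBFact R D)) (S : Set D) : Set (DBFact R D) :=
  {fc ∈ I | fc.valsIn S}

theorem adom_restrictTo_subset {R D : Type} (I : Set (DBFact R D)) (S : Set D) :
    adom (restrictTo I S) ⊆ S := by
  rintro d ⟨fc, hfc, hd⟩
  exact hfc.2 d hd

namespace CQ

variable {R V D : Type}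

theorem finite_vars (Q : CQ R V) : Q.vars.Finite := by
  have hatom : ∀ a : Atom R V, a.vars.Finite := fun a => a.args.finite_toSet
  refine (((hatom _).union ?_).union ?_).union ?_
  · exact Q.pos.finite_toSet.biUnion fun a _ => hatom a
  · exact Q.neg.finite_toSet.biUnion fun a _ => hatom a
  · exact Q.ineq.finite_toSet.biUnion fun p _ => Set.toFinite _

theorem args_subset_vars_of_mem_pos {Q : CQ R V} {a : Atom R V} (ha : a ∈ Q.pos) :
    a.vars ⊆ Q.vars := fun _ hv =>
  Or.inl (Or.inl (Or.inr (Set.mem_biUnion (Finset.mem_coe.2 ha) hv)))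

/-- A satisfying valuation on `I` still satisfies `Q` on the facts of `I` over its own values. -/
theorem sat_restrictTo_image_vars {Q : CQ R V} {f : V → D} {I : Set (DBFact R D)}
    (h : Q.sat f I) : Q.sat f (restrictTo I (f '' Q.vars)) := by
  refine ⟨?_, Set.subset_eq_empty (Set.inter_subset_inter_right _ fun _ hx => hx.1) h.2⟩
  rintro _ ⟨a, ha, rfl⟩
  refine ⟨h.1 ⟨a, ha, rfl⟩, fun d hd => ?_⟩
  obtain ⟨v, hv, rfl⟩ := List.mem_map.1 hd
  exact ⟨v, args_subset_vars_of_mem_pos ha hv, rfl⟩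

/-- For a safe query, restricting an instance to the facts over a set of values is monotone:
prohibited facts only use values of required facts. -/
theorem eval_restrictTo_inter_subset {Q : CQ R V} (hQ : Q.safe) (I L : Set (DBFact R D))
    (S : Set D) : Q.eval (restrictTo I S ∩ L) ⊆ Q.eval (I ∩ L) := by
  rintro _ ⟨f, hval, ⟨hpos, hneg⟩, rfl⟩
  refine ⟨f, hval, ⟨fun x hx => ⟨(hpos hx).1.1, (hpos hx).2⟩, ?_⟩, rfl⟩
  refine Set.eq_empty_iff_forall_notMem.2 ?_
  rintro _ ⟨⟨a, ha, rfl⟩, hI, hL⟩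
  refine (Set.eq_empty_iff_forall_notMem.1 hneg) _ ⟨⟨a, ha, rfl⟩, ⟨hI, fun d hd => ?_⟩, hL⟩
  obtain ⟨v, hv, rfl⟩ := List.mem_map.1 hd
  obtain ⟨b, hb, hvb⟩ := hQ.2 a ha v hv
  exact (hpos ⟨b, hb, rfl⟩).1.2 _ (List.mem_map_of_mem hvb)

end CQ

/-- If a UCQ¬,≠ `Q` is not parallel-complete under `ρ`, then
there is a counterexample instance `J` over the universe of `ρ` with
`|adom(J)| ≤ varmax(Q)`. -/
theorem ucq_neg_parallel_complete_small_counterexample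
    {R V D K : Type} [Infinite D] [Fintype K] [Nonempty K]
    (Q : UCQ R V) (hQ : Q.wf) (ρ : Policy R D K)
    (h : ¬ parComplete (fun I => Q.eval I) ρ) :
    ∃ J : Set (DBFact R D), instOver J ρ.U ∧ (adom J).ncard ≤ Q.varmax ∧
      ¬ parCompleteOn (fun I => Q.eval I) ρ J := by
  obtain ⟨I, hI, hnc⟩ : ∃ I, instOver I ρ.U ∧ ¬ parCompleteOn (fun I => Q.eval I) ρ I := by
    simpa [parComplete] using h
  obtain ⟨fc, hfc, hnot⟩ := Set.not_subset.1 hnc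
  obtain ⟨i, f, hval, hsat, rfl⟩ := Set.mem_iUnion.1 hfc
  have hfin := (Q.disj i).finite_vars
  refine ⟨restrictTo I (f '' (Q.disj i).vars),
    ⟨hI.1.subset fun _ hx => hx.1, fun _ hx => hI.2 _ hx.1⟩, ?_, fun hcomp => hnot ?_⟩
  · calc (adom (restrictTo I (f '' (Q.disj i).vars))).ncard
        ≤ (f '' (Q.disj i).vars).ncard :=
          Set.ncard_le_ncard (adom_restrictTo_subset _ _) (hfin.image f)
      _ ≤ (Q.disj i).vars.ncard := Set.ncard_image_le hfin
      _ ≤ Q.varmax :=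
          Finset.le_sup (f := fun i => ((Q.disj i).vars).ncard) (Finset.mem_univ i)
  · have hmem := hcomp (Set.mem_iUnion.2 ⟨i, f, hval, CQ.sat_restrictTo_image_vars hsat, rfl⟩)
    obtain ⟨κ, hκ⟩ := Set.mem_iUnion.1 hmem
    obtain ⟨j, hj⟩ := Set.mem_iUnion.1 hκ
    exact Set.mem_iUnion.2 ⟨κ, Set.mem_iUnion.2
      ⟨j, CQ.eval_restrictTo_inter_subset (hQ.1 j) _ _ _ hj⟩⟩
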